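/- arXiv:1806.04129 — 3 statements merged into one kernel-verified Lean document; each statement's English description precedes it below -/
import Mathlib

section
/- Let 0 < s < 1 and let k, n be integers with n > 0 and gcd(k,n) = 1. Then Δ_s⁺(k/n) − Δ_s⁻(k/n) = s^{n−2}(1−s)²/(1−s^n). -/
open scoped BigOperators

/-- `Δ_s⁻(x) = ((1−s)/s)² · ∑_{j=1}^∞ s^j ⌈jx⌉`. -/
noncomputable def DeltaMinus (s x : ℝ) : ℝ :=
  ((1 - s) / s) ^ 2 * ∑' j : ℕ, s ^ (j + 1) * ((⌈((j : ℝ) + 1) * x⌉ : ℤ) : ℝ)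

/-- `Δ_s⁺(x) = (1−s)/s + ((1−s)/s)² · ∑_{j=1}^∞ s^j ⌊jx⌋`. -/
noncomputable def DeltaPlus (s x : ℝ) : ℝ :=
  (1 - s) / s + ((1 - s) / s) ^ 2 * ∑' j : ℕ, s ^ (j + 1) * ((⌊((j : ℝ) + 1) * x⌋ : ℤ) : ℝ)

theorem summable_pow_mul_floor {s : ℝ} (hs0 : 0 ≤ s) (hs1 : s < 1) (x : ℝ) :
    Summable fun j : ℕ => s ^ (j + 1) * ((⌊((j : ℝ) + 1) * x⌋ : ℤ) : ℝ) := by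
  have hgeom : Summable fun j : ℕ => s ^ j := summable_geometric_of_lt_one hs0 hs1
  have hlin : Summable fun j : ℕ => (j : ℝ) ^ 1 * s ^ j :=
    summable_pow_mul_geometric_of_norm_lt_one 1 (by rwa [Real.norm_of_nonneg hs0])
  have hbound : Summable fun j : ℕ => s ^ (j + 1) * (((j + 1 : ℕ) : ℝ) * |x| + 1) := by
    refine (summable_nat_add_iff (f := fun j : ℕ => s ^ j * ((j : ℝ) * |x| + 1)) 1).2 ?_
    exact ((hlin.mul_right |x|).add hgeom).congr fun j => by ring
  refine hbound.of_norm_bounded fun j => ?_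
  rw [norm_mul, Real.norm_of_nonneg (pow_nonneg hs0 _), Real.norm_eq_abs]
  refine mul_le_mul_of_nonneg_left ?_ (pow_nonneg hs0 _)
  have h1 := Int.floor_le (((j : ℝ) + 1) * x)
  have h2 := Int.lt_floor_add_one (((j : ℝ) + 1) * x)
  have h3 : |((j : ℝ) + 1) * x| = ((j : ℝ) + 1) * |x| := by
    rw [abs_mul, abs_of_nonneg (by positivity)]
  have h4 := neg_abs_le (((j : ℝ) + 1) * x)
  have h5 := le_abs_self (((j : ℝ) + 1) * x)
  push_cast
  rw [abs_le]
  constructor <;> linarith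

theorem summable_pow_mul_ceil {s : ℝ} (hs0 : 0 ≤ s) (hs1 : s < 1) (x : ℝ) :
    Summable fun j : ℕ => s ^ (j + 1) * ((⌈((j : ℝ) + 1) * x⌉ : ℤ) : ℝ) :=
  (summable_pow_mul_floor hs0 hs1 (-x)).neg.congr fun j => by
    rw [mul_neg, Int.floor_neg]
    push_cast
    ring

theorem ceil_mul_div_eq_floor_add {k : ℤ} {n : ℕ} (hn : 0 < n) (hgcd : Int.gcd k n = 1)
    (j : ℕ) :
    ⌈(j : ℝ) * ((k : ℝ) / (n : ℝ))⌉ =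
      ⌊(j : ℝ) * ((k : ℝ) / (n : ℝ))⌋ + if n ∣ j then 0 else 1 := by
  have hn0 : (n : ℝ) ≠ 0 := by exact_mod_cast hn.ne'
  split_ifs with h
  · obtain ⟨c, rfl⟩ := h
    have hc : ((n * c : ℕ) : ℝ) * ((k : ℝ) / (n : ℝ)) = ((c * k : ℤ) : ℝ) := by
      push_cast
      field_simp
    rw [hc, Int.ceil_intCast, Int.floor_intCast, add_zero]
  · refine (Int.ceil_eq_floor_add_one_iff_notMem _).2 ?_
    rintro ⟨z, hz⟩
    have hmul : (j : ℤ) * k = n * z := by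
      have : (j : ℝ) * k = n * z := by
        rw [hz]
        field_simp
      exact_mod_cast this
    have hdvd : (n : ℤ) ∣ j :=
      (Int.isCoprime_iff_gcd_eq_one.2 hgcd).symm.dvd_of_dvd_mul_right ⟨z, hmul⟩
    exact h (by exact_mod_cast hdvd)

theorem hasSum_pow_ite_dvd {s : ℝ} (hs0 : 0 ≤ s) (hs1 : s < 1) {n : ℕ} (hn : 0 < n) :
    HasSum (fun j : ℕ => if n ∣ j + 1 then s ^ (j + 1) else 0) (s ^ n / (1 - s ^ n)) := by
  have hsucc (m : ℕ) : n * (m + 1) - 1 + 1 = n * (m + 1) :=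
    Nat.sub_add_cancel (Nat.mul_pos hn m.succ_pos)
  have hinj : Function.Injective fun m : ℕ => n * (m + 1) - 1 := by
    intro a b hab
    have h : n * (a + 1) = n * (b + 1) := by
      rw [← hsucc a, ← hsucc b]
      exact congrArg (· + 1) hab
    exact Nat.succ_injective (Nat.eq_of_mul_eq_mul_left hn h)
  refine (hinj.hasSum_iff ?_).1 ?_
  · intro j hj
    refine if_neg fun ⟨c, hc⟩ => hj ?_
    obtain _ | c := c
    · simp at hc
    · exact ⟨c, by simp [← hc]⟩
  · have hgeom := (hasSum_geometric_of_lt_one (pow_nonneg hs0 n)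
      (pow_lt_one₀ hs0 hs1 hn.ne')).mul_left (s ^ n)
    rw [← div_eq_mul_inv] at hgeom
    refine hgeom.congr_fun fun m => ?_
    simp only [Function.comp_apply, hsucc, dvd_mul_right, if_true]
    rw [pow_mul, pow_succ']

theorem stmt_6 (s : ℝ) (hs0 : 0 < s) (hs1 : s < 1) (k n : ℤ) (hn : 0 < n)
    (hgcd : Int.gcd k n = 1) :
    DeltaPlus s ((k : ℝ) / (n : ℝ)) - DeltaMinus s ((k : ℝ) / (n : ℝ)) =
      s ^ (n - 2) * (1 - s) ^ 2 / (1 - s ^ n) := by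
  lift n to ℕ using hn.le
  have hN : 0 < n := by exact_mod_cast hn
  have hpow : s ^ n < 1 := pow_lt_one₀ hs0.le hs1 hN.ne'
  have hfloor := summable_pow_mul_floor hs0.le hs1 ((k : ℝ) / (n : ℝ))
  have hceil := summable_pow_mul_ceil hs0.le hs1 ((k : ℝ) / (n : ℝ))
  have hgeom : HasSum (fun j : ℕ => s ^ (j + 1)) (s / (1 - s)) := by
    simpa [pow_succ', div_eq_mul_inv] using (hasSum_geometric_of_lt_one hs0.le hs1).mul_left s
  have hdiff : ∑' j : ℕ, s ^ (j + 1) * ((⌊((j : ℝ) + 1) * ((k : ℝ) / (n : ℝ))⌋ : ℤ) : ℝ) -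
      ∑' j : ℕ, s ^ (j + 1) * ((⌈((j : ℝ) + 1) * ((k : ℝ) / (n : ℝ))⌉ : ℤ) : ℝ) =
      s ^ n / (1 - s ^ n) - s / (1 - s) := by
    rw [← hfloor.tsum_sub hceil,
      ← ((hasSum_pow_ite_dvd hs0.le hs1 hN).sub hgeom).tsum_eq]
    refine tsum_congr fun j => ?_
    have h := ceil_mul_div_eq_floor_add hN hgcd (j + 1)
    push_cast at h
    rw [h]
    split_ifs <;> push_cast <;> ring
  unfold DeltaPlus DeltaMinus
  have hz : s ^ ((n : ℤ) - 2) = s ^ n / s ^ 2 := by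
    rw [zpow_sub₀ hs0.ne']
    norm_cast
  have h1 : 1 - s ≠ 0 := by linarith
  have h2 : 1 - s ^ n ≠ 0 := by linarith
  simp only [Int.cast_natCast, zpow_natCast, hz]
  rw [add_sub_assoc, ← mul_sub, hdiff]
  field_simp
  ring
end

section
/- For every s with 0 < s < 1, the set C_s (the closure in ℝ of the union of the images of Δ_s⁻ and Δ_s⁺) has Lebesgue measure zero, is a perfect set (it has no isolated points), and is totally disconnected. -/
open scoped BigOperators

open Set Filter Topology MeasureTheory

/-- The weights `s ^ (j + 1) * (j + 1)` sum to `s / (1 - s) ^ 2`. -/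
lemma hasSum_pow_succ_mul_succ {s : ℝ} (hs0 : 0 < s) (hs1 : s < 1) :
    HasSum (fun j : ℕ => s ^ (j + 1) * ((j : ℝ) + 1)) (s / (1 - s) ^ 2) := by
  have h := hasSum_coe_mul_geometric_of_norm_lt_one (r := s)
    (by rwa [Real.norm_eq_abs, abs_of_pos hs0])
  rw [← hasSum_nat_add_iff' 1] at h
  simpa [mul_comm] using h

lemma hasSum_pow_succ {s : ℝ} (hs0 : 0 < s) (hs1 : s < 1) :
    HasSum (fun j : ℕ => s ^ (j + 1)) (s / (1 - s)) := by
  simpa [pow_succ', div_eq_mul_inv] using (hasSum_geometric_of_lt_one hs0.le hs1).mul_left s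

lemma abs_ceil_le (y : ℝ) : |((⌈y⌉ : ℤ) : ℝ)| ≤ |y| + 1 := by
  have h1 := Int.le_ceil y
  have h2 := Int.ceil_lt_add_one y
  rw [abs_le]
  constructor <;> linarith [neg_abs_le y, le_abs_self y]

lemma norm_pow_succ_mul_ceil_le {s x B : ℝ} (hs0 : 0 < s) (hx : |x| ≤ B) (j : ℕ) :
    ‖s ^ (j + 1) * ((⌈((j : ℝ) + 1) * x⌉ : ℤ) : ℝ)‖
      ≤ s ^ (j + 1) * ((j : ℝ) + 1) * B + s ^ (j + 1) := by
  have hj : (0 : ℝ) < (j : ℝ) + 1 := by positivity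
  rw [norm_mul, Real.norm_eq_abs, Real.norm_eq_abs, abs_of_pos (pow_pos hs0 _)]
  calc s ^ (j + 1) * |((⌈((j : ℝ) + 1) * x⌉ : ℤ) : ℝ)|
      ≤ s ^ (j + 1) * (((j : ℝ) + 1) * B + 1) := by
        gcongr
        refine (abs_ceil_le _).trans ?_
        rw [abs_mul, abs_of_pos hj]
        gcongr
    _ = _ := by ring

lemma summable_ceil_bound {s : ℝ} (hs0 : 0 < s) (hs1 : s < 1) (B : ℝ) :
    Summable fun j : ℕ => s ^ (j + 1) * ((j : ℝ) + 1) * B + s ^ (j + 1) :=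
  ((hasSum_pow_succ_mul_succ hs0 hs1).summable.mul_right B).add (hasSum_pow_succ hs0 hs1).summable

lemma summable_pow_succ_mul_ceil {s : ℝ} (hs0 : 0 < s) (hs1 : s < 1) (x : ℝ) :
    Summable fun j : ℕ => s ^ (j + 1) * ((⌈((j : ℝ) + 1) * x⌉ : ℤ) : ℝ) :=
  .of_norm_bounded (summable_ceil_bound hs0 hs1 |x|)
    fun j => norm_pow_succ_mul_ceil_le hs0 le_rfl j

lemma summable_pow_succ_mul_floor {s : ℝ} (hs0 : 0 < s) (hs1 : s < 1) (x : ℝ) :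
    Summable fun j : ℕ => s ^ (j + 1) * ((⌊((j : ℝ) + 1) * x⌋ : ℤ) : ℝ) := by
  simpa [mul_neg, Int.ceil_neg] using (summable_pow_succ_mul_ceil hs0 hs1 (-x)).neg

lemma summable_pow_succ_mul_floor_add_one {s : ℝ} (hs0 : 0 < s) (hs1 : s < 1) (x : ℝ) :
    Summable fun j : ℕ => s ^ (j + 1) * (((⌊((j : ℝ) + 1) * x⌋ : ℤ) : ℝ) + 1) := by
  simpa [mul_add] using
    (summable_pow_succ_mul_floor hs0 hs1 x).add (hasSum_pow_succ hs0 hs1).summable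

lemma DeltaPlus_eq_neg (s x : ℝ) : DeltaPlus s x = (1 - s) / s - DeltaMinus s (-x) := by
  simp [DeltaPlus, DeltaMinus, mul_neg, Int.ceil_neg, tsum_neg]

lemma DeltaPlus_eq_tsum {s : ℝ} (hs0 : 0 < s) (hs1 : s < 1) (x : ℝ) :
    DeltaPlus s x = ((1 - s) / s) ^ 2 *
      ∑' j : ℕ, s ^ (j + 1) * (((⌊((j : ℝ) + 1) * x⌋ : ℤ) : ℝ) + 1) := by
  have h := (summable_pow_succ_mul_floor hs0 hs1 x).tsum_add (hasSum_pow_succ hs0 hs1).summable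
  have h1 : 1 - s ≠ 0 := by linarith
  simp only [mul_add, mul_one]
  rw [h, (hasSum_pow_succ hs0 hs1).tsum_eq, DeltaPlus, mul_add, add_comm]
  congr 1
  field_simp

lemma gap_factor_pos {s : ℝ} (hs0 : 0 < s) (hs1 : s < 1) : 0 < ((1 - s) / s) ^ 2 := by
  have : 0 < 1 - s := by linarith
  positivity

lemma DeltaPlus_lt_DeltaMinus {s : ℝ} (hs0 : 0 < s) (hs1 : s < 1) {x y : ℝ} (hxy : x < y) :
    DeltaPlus s x < DeltaMinus s y := by
  rw [DeltaPlus_eq_tsum hs0 hs1, DeltaMinus]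
  refine mul_lt_mul_of_pos_left ?_ (gap_factor_pos hs0 hs1)
  obtain ⟨i, hi⟩ := exists_nat_gt (1 / (y - x))
  rw [div_lt_iff₀ (by linarith)] at hi
  refine Summable.tsum_lt_tsum (i := i) (fun j => ?_) ?_
    (summable_pow_succ_mul_floor_add_one hs0 hs1 x) (summable_pow_succ_mul_ceil hs0 hs1 y)
  · refine mul_le_mul_of_nonneg_left ?_ (pow_pos hs0 _).le
    have : ⌊((j : ℝ) + 1) * x⌋ < ⌈((j : ℝ) + 1) * y⌉ := by
      have h : ((j : ℝ) + 1) * x < ((j : ℝ) + 1) * y := by gcongr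
      exact_mod_cast (Int.floor_le _).trans_lt (h.trans_le (Int.le_ceil _))
    simpa using Int.cast_le (R := ℝ) |>.2 (Int.add_one_le_of_lt this)
  · refine mul_lt_mul_of_pos_left ?_ (pow_pos hs0 _)
    have h1 := Int.floor_le (((i : ℝ) + 1) * x)
    have h2 := Int.le_ceil (((i : ℝ) + 1) * y)
    nlinarith

lemma DeltaPlus_sub_DeltaMinus {s : ℝ} (hs0 : 0 < s) (hs1 : s < 1) (x : ℝ) :
    HasSum (fun j : ℕ => ((1 - s) / s) ^ 2 * (s ^ (j + 1) *
      (((⌊((j : ℝ) + 1) * x⌋ : ℤ) : ℝ) + 1 - ((⌈((j : ℝ) + 1) * x⌉ : ℤ) : ℝ))))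
      (DeltaPlus s x - DeltaMinus s x) := by
  rw [DeltaPlus_eq_tsum hs0 hs1, DeltaMinus, ← mul_sub]
  simp only [mul_sub (s ^ _)]
  exact ((summable_pow_succ_mul_floor_add_one hs0 hs1 x).hasSum.sub
    (summable_pow_succ_mul_ceil hs0 hs1 x).hasSum).mul_left _

lemma gap_term_nonneg {s : ℝ} (hs0 : 0 < s) (x : ℝ) (j : ℕ) :
    0 ≤ ((1 - s) / s) ^ 2 * (s ^ (j + 1) *
      (((⌊((j : ℝ) + 1) * x⌋ : ℤ) : ℝ) + 1 - ((⌈((j : ℝ) + 1) * x⌉ : ℤ) : ℝ))) := by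
  have : ((⌈((j : ℝ) + 1) * x⌉ : ℤ) : ℝ) ≤ ((⌊((j : ℝ) + 1) * x⌋ : ℤ) : ℝ) + 1 :=
    mod_cast Int.ceil_le_floor_add_one _
  have := sub_nonneg.2 this
  positivity

lemma DeltaMinus_le_DeltaPlus {s : ℝ} (hs0 : 0 < s) (hs1 : s < 1) (x : ℝ) :
    DeltaMinus s x ≤ DeltaPlus s x :=
  sub_nonneg.1 ((DeltaPlus_sub_DeltaMinus hs0 hs1 x).nonneg (gap_term_nonneg hs0 x))

lemma DeltaMinus_strictMono {s : ℝ} (hs0 : 0 < s) (hs1 : s < 1) : StrictMono (DeltaMinus s) :=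
  fun x _ hxy => (DeltaMinus_le_DeltaPlus hs0 hs1 x).trans_lt (DeltaPlus_lt_DeltaMinus hs0 hs1 hxy)

lemma DeltaMinus_intCast {s : ℝ} (hs0 : 0 < s) (hs1 : s < 1) (n : ℤ) :
    DeltaMinus s n = n / s := by
  have h (j : ℕ) : ⌈((j : ℝ) + 1) * n⌉ = ((j : ℤ) + 1) * n := by
    rw [← Int.ceil_intCast (R := ℝ) (((j : ℤ) + 1) * n)]; push_cast; rfl
  have h1 : 1 - s ≠ 0 := by linarith
  simp only [DeltaMinus, h]
  push_cast
  simp only [← mul_assoc]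
  rw [tsum_mul_right, (hasSum_pow_succ_mul_succ hs0 hs1).tsum_eq]
  field_simp

lemma tendsto_DeltaMinus_left {s : ℝ} (hs0 : 0 < s) (hs1 : s < 1) (x : ℝ) :
    Tendsto (DeltaMinus s) (𝓝[<] x) (𝓝 (DeltaMinus s x)) := by
  refine Tendsto.const_mul _ (tendsto_tsum_of_dominated_convergence
    (summable_ceil_bound hs0 hs1 (|x| + 1)) (fun j => ?_) ?_)
  · refine (tendsto_const_nhds (x := _)).congr' ?_
    have hlt : ((⌈((j : ℝ) + 1) * x⌉ : ℤ) : ℝ) - 1 < ((j : ℝ) + 1) * x := by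
      linarith [Int.ceil_lt_add_one (((j : ℝ) + 1) * x)]
    have hc : Tendsto (fun y : ℝ => ((j : ℝ) + 1) * y) (𝓝[<] x) (𝓝 (((j : ℝ) + 1) * x)) :=
      (by fun_prop : Continuous fun y : ℝ => ((j : ℝ) + 1) * y).continuousAt.mono_left
        nhdsWithin_le_nhds
    filter_upwards [hc.eventually_const_lt hlt, self_mem_nhdsWithin] with y hy hyx
    have : ⌈((j : ℝ) + 1) * y⌉ = ⌈((j : ℝ) + 1) * x⌉ := by
      refine Int.ceil_eq_iff.2 ⟨hy, le_trans ?_ (Int.le_ceil _)⟩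
      exact mul_le_mul_of_nonneg_left (le_of_lt hyx) (by positivity)
    rw [this]
  · have : Ioo (x - 1) x ∈ 𝓝[<] x := Ioo_mem_nhdsLT (by linarith)
    filter_upwards [this] with y hy j
    refine norm_pow_succ_mul_ceil_le hs0 ?_ j
    rw [abs_le]
    constructor <;> linarith [hy.1, hy.2, neg_abs_le x, le_abs_self x]

lemma accPt_DeltaMinus {s : ℝ} (hs0 : 0 < s) (hs1 : s < 1) (x : ℝ) :
    AccPt (DeltaMinus s x) (𝓟 (range (DeltaMinus s))) := by
  rw [accPt_iff_frequently]
  refine (tendsto_DeltaMinus_left hs0 hs1 x).frequently (Eventually.frequently ?_)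
  filter_upwards [self_mem_nhdsWithin] with y hy
  exact ⟨(DeltaMinus_strictMono hs0 hs1 hy).ne, mem_range_self y⟩

lemma accPt_DeltaPlus {s : ℝ} (hs0 : 0 < s) (hs1 : s < 1) (x : ℝ) :
    AccPt (DeltaPlus s x) (𝓟 (range (DeltaPlus s))) := by
  have h := accPt_iff_frequently.1 (accPt_DeltaMinus hs0 hs1 (-x))
  rw [accPt_iff_frequently, DeltaPlus_eq_neg]
  have hc : Tendsto (fun z => (1 - s) / s - z) (𝓝 (DeltaMinus s (-x)))
      (𝓝 ((1 - s) / s - DeltaMinus s (-x))) :=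
    (by fun_prop : Continuous fun z : ℝ => (1 - s) / s - z).continuousAt
  refine hc.frequently (h.mono ?_)
  rintro _ ⟨hne, y, rfl⟩
  refine ⟨fun h => hne (by linarith), -y, ?_⟩
  rw [DeltaPlus_eq_neg, neg_neg]

lemma perfect_closure_range_Delta {s : ℝ} (hs0 : 0 < s) (hs1 : s < 1) :
    Perfect (closure (range (DeltaMinus s) ∪ range (DeltaPlus s))) := by
  refine Preperfect.perfect_closure ?_
  rintro _ (⟨x, rfl⟩ | ⟨x, rfl⟩)
  · exact (accPt_DeltaMinus hs0 hs1 x).mono (principal_mono.2 subset_union_left)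
  · exact (accPt_DeltaPlus hs0 hs1 x).mono (principal_mono.2 subset_union_right)

lemma disjoint_gap_closure {s : ℝ} (hs0 : 0 < s) (hs1 : s < 1) (x : ℝ) :
    Disjoint (Ioo (DeltaMinus s x) (DeltaPlus s x))
      (closure (range (DeltaMinus s) ∪ range (DeltaPlus s))) := by
  refine Disjoint.closure_right ?_ isOpen_Ioo
  rw [Set.disjoint_left]
  rintro _ ⟨h1, h2⟩ (⟨y, rfl⟩ | ⟨y, rfl⟩)
  · exact h2.not_ge (DeltaPlus_lt_DeltaMinus hs0 hs1
      ((DeltaMinus_strictMono hs0 hs1).lt_iff_lt.1 h1)).le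
  · rcases lt_or_ge y x with h | h
    · exact h1.not_gt (DeltaPlus_lt_DeltaMinus hs0 hs1 h)
    · rcases h.eq_or_lt with rfl | h
      · exact h2.false
      · exact h2.not_ge ((DeltaPlus_lt_DeltaMinus hs0 hs1 h).le.trans
          (DeltaMinus_le_DeltaPlus hs0 hs1 y))

lemma gap_term_add_div {s : ℝ} (n : ℤ) (j k : ℕ) :
    ((1 - s) / s) ^ 2 * (s ^ (j + 1) *
      (((⌊((j : ℝ) + 1) * ((n : ℝ) + k / ((j : ℝ) + 1))⌋ : ℤ) : ℝ) + 1
        - ((⌈((j : ℝ) + 1) * ((n : ℝ) + k / ((j : ℝ) + 1))⌉ : ℤ) : ℝ)))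
      = ((1 - s) / s) ^ 2 * s ^ (j + 1) := by
  have h : ((j : ℝ) + 1) * ((n : ℝ) + k / ((j : ℝ) + 1)) = ((((j : ℤ) + 1) * n + k : ℤ) : ℝ) := by
    have : (j : ℝ) + 1 ≠ 0 := by positivity
    push_cast
    field_simp
  rw [h, Int.floor_intCast, Int.ceil_intCast]
  ring

/-- The gaps over the rationals in `[n, n + 1)` have total length at least `1 / s`. -/
lemma inv_le_tsum_gap {s : ℝ} (hs0 : 0 < s) (hs1 : s < 1) (n : ℤ) :
    ENNReal.ofReal (1 / s) ≤ ∑' r : {r : ℚ // (n : ℚ) ≤ r ∧ r < n + 1},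
      ENNReal.ofReal (DeltaPlus s (r : ℚ) - DeltaMinus s (r : ℚ)) := by
  have h1 : 1 - s ≠ 0 := by linarith
  have hsum := (hasSum_pow_succ_mul_succ hs0 hs1).mul_left (((1 - s) / s) ^ 2)
  have hval : ((1 - s) / s) ^ 2 * (s / (1 - s) ^ 2) = 1 / s := by field_simp
  rw [hval] at hsum
  have hgap (x : ℝ) := DeltaPlus_sub_DeltaMinus hs0 hs1 x
  simp_rw [← (hgap _).tsum_eq,
    ENNReal.ofReal_tsum_of_nonneg (gap_term_nonneg hs0 _) (hgap _).summable]
  rw [ENNReal.tsum_comm, ← hsum.tsum_eq,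
    ENNReal.ofReal_tsum_of_nonneg (fun j => by positivity) hsum.summable]
  refine ENNReal.tsum_le_tsum fun j => ?_
  let f : Fin (j + 1) → {r : ℚ // (n : ℚ) ≤ r ∧ r < n + 1} := fun k =>
    ⟨n + (k : ℕ) / ((j : ℚ) + 1), by
      have : (0 : ℚ) ≤ (k : ℕ) / ((j : ℚ) + 1) := by positivity
      linarith, by
      have : ((k : ℕ) : ℚ) / ((j : ℚ) + 1) < 1 := by
        rw [div_lt_one (by positivity)]
        exact_mod_cast k.2
      linarith⟩
  have hf : Function.Injective f := by
    intro a b hab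
    have hj : (j : ℚ) + 1 ≠ 0 := by positivity
    have := congrArg Subtype.val hab
    simp only [f, add_right_inj, div_left_inj' hj, Nat.cast_inj] at this
    exact Fin.ext this
  refine le_trans ?_ (ENNReal.tsum_comp_le_tsum_of_injective hf _)
  have hterm (k : Fin (j + 1)) : (((f k : ℚ)) : ℝ) = (n : ℝ) + (k : ℕ) / ((j : ℝ) + 1) := by
    simp [f]
  simp only [hterm, gap_term_add_div]
  rw [tsum_fintype, Finset.sum_const, Finset.card_univ, Fintype.card_fin, nsmul_eq_mul,
    ← mul_assoc, mul_comm, ENNReal.ofReal_mul (by positivity)]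
  gcongr
  exact le_of_eq (by rw [← Nat.cast_succ, ENNReal.ofReal_natCast])

lemma volume_closure_inter_Ico {s : ℝ} (hs0 : 0 < s) (hs1 : s < 1) (n : ℤ) :
    volume (closure (range (DeltaMinus s) ∪ range (DeltaPlus s)) ∩
      Ico ((n : ℝ) / s) (((n : ℝ) + 1) / s)) = 0 := by
  let G : {r : ℚ // (n : ℚ) ≤ r ∧ r < n + 1} → Set ℝ := fun r =>
    Ioo (DeltaMinus s (r : ℚ)) (DeltaPlus s (r : ℚ))
  have hG (r) : MeasurableSet (G r) := measurableSet_Ioo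
  have hdisj : Pairwise (Function.onFun Disjoint G) := by
    refine (pairwise_disjoint_on G).2 fun a b hab => ?_
    refine Set.disjoint_left.2 fun z hza hzb => ?_
    have : ((a : ℚ) : ℝ) < ((b : ℚ) : ℝ) := by exact_mod_cast hab
    exact (hza.2.trans (DeltaPlus_lt_DeltaMinus hs0 hs1 this)).not_gt hzb.1
  have hleft : DeltaMinus s n = n / s := DeltaMinus_intCast hs0 hs1 n
  have hright : DeltaMinus s ((n : ℝ) + 1) = ((n : ℝ) + 1) / s := by
    exact_mod_cast DeltaMinus_intCast hs0 hs1 (n + 1)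
  have hsub : (⋃ r, G r) ⊆ Ico ((n : ℝ) / s) (((n : ℝ) + 1) / s) := by
    refine iUnion_subset fun r z hz => ⟨?_, ?_⟩
    · rw [← hleft]
      refine ((DeltaMinus_strictMono hs0 hs1).monotone ?_).trans hz.1.le
      exact_mod_cast r.2.1
    · rw [← hright]
      refine hz.2.trans (DeltaPlus_lt_DeltaMinus hs0 hs1 ?_)
      exact_mod_cast r.2.2
  have hvol : volume (Ico ((n : ℝ) / s) (((n : ℝ) + 1) / s)) = ENNReal.ofReal (1 / s) := by
    rw [Real.volume_Ico]
    congr 1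
    ring
  have hle : volume (Ico ((n : ℝ) / s) (((n : ℝ) + 1) / s)) ≤ volume (⋃ r, G r) := by
    rw [hvol, measure_iUnion hdisj hG]
    simpa only [G, Real.volume_Ioo] using inv_le_tsum_gap hs0 hs1 n
  have hfin : volume (⋃ r, G r) ≠ ⊤ :=
    ((measure_mono hsub).trans_lt (by rw [hvol]; exact ENNReal.ofReal_lt_top)).ne
  refine measure_mono_null (t := Ico ((n : ℝ) / s) (((n : ℝ) + 1) / s) \ ⋃ r, G r) ?_ ?_
  · rintro z ⟨hz, hzI⟩
    refine ⟨hzI, fun hzG => ?_⟩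
    obtain ⟨r, hr⟩ := mem_iUnion.1 hzG
    exact Set.disjoint_left.1 (disjoint_gap_closure hs0 hs1 _) hr hz
  · rw [measure_sdiff hsub (MeasurableSet.iUnion hG).nullMeasurableSet hfin]
    exact tsub_eq_zero_of_le hle

lemma volume_closure_range_Delta {s : ℝ} (hs0 : 0 < s) (hs1 : s < 1) :
    volume (closure (range (DeltaMinus s) ∪ range (DeltaPlus s))) = 0 := by
  refine measure_mono_null ?_ (measure_iUnion_null (volume_closure_inter_Ico hs0 hs1))
  intro z hz
  refine mem_iUnion.2 ⟨⌊z * s⌋, hz, ?_, ?_⟩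
  · rw [div_le_iff₀ hs0]
    exact Int.floor_le _
  · rw [lt_div_iff₀ hs0]
    exact Int.lt_floor_add_one _

lemma isTotallyDisconnected_of_volume_eq_zero {S : Set ℝ} (hS : volume S = 0) :
    IsTotallyDisconnected S := by
  have key {t : Set ℝ} (hts : t ⊆ S) (ht : IsPreconnected t) {a b : ℝ} (ha : a ∈ t)
      (hb : b ∈ t) : b ≤ a := by
    have h := measure_mono_null ((ht.Icc_subset ha hb).trans hts) hS
    rw [Real.volume_Icc, ENNReal.ofReal_eq_zero] at h
    linarith
  exact fun t hts ht a ha b hb => le_antisymm (key hts ht hb ha) (key hts ht ha hb)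

theorem stmt_9 (s : ℝ) (hs0 : 0 < s) (hs1 : s < 1) :
    MeasureTheory.volume
        (closure (Set.range (DeltaMinus s) ∪ Set.range (DeltaPlus s))) = 0 ∧
    Perfect (closure (Set.range (DeltaMinus s) ∪ Set.range (DeltaPlus s))) ∧
    IsTotallyDisconnected
        (closure (Set.range (DeltaMinus s) ∪ Set.range (DeltaPlus s))) :=
  ⟨volume_closure_range_Delta hs0 hs1, perfect_closure_range_Delta hs0 hs1,
    isTotallyDisconnected_of_volume_eq_zero (volume_closure_range_Delta hs0 hs1)⟩
end

section
/- Let ξ > 0 be irrational. Then for every x ∈ ℝ, lim_{s→1⁻} Υ_{s,ξ}⁻(x) = x and lim_{s→1⁻} Υ_{s,ξ}⁺(x) = x, where the limits are taken as s tends to 1 from below within (0,1). -/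
open scoped BigOperators

/-- `Υ_{s,ξ}⁻(x) = ((1−s)/s) · ∑_{j=1}^∞ s^j ⌈x − {jξ}⌉`. -/
noncomputable def UpsilonMinus (s ξ x : ℝ) : ℝ :=
  (1 - s) / s * ∑' j : ℕ, s ^ (j + 1) * ((⌈x - Int.fract (((j : ℝ) + 1) * ξ)⌉ : ℤ) : ℝ)

/-- `Υ_{s,ξ}⁺(x) = 1 + ((1−s)/s) · ∑_{j=1}^∞ s^j ⌊x − {jξ}⌋`. -/
noncomputable def UpsilonPlus (s ξ x : ℝ) : ℝ :=
  1 + (1 - s) / s * ∑' j : ℕ, s ^ (j + 1) * ((⌊x - Int.fract (((j : ℝ) + 1) * ξ)⌋ : ℤ) : ℝ)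

open Filter Topology

/-- The Abel mean `((1 - s) / s) * ∑_{j ≥ 0} s ^ (j + 1) * a j` of a sequence. -/
noncomputable def abelMean (a : ℕ → ℝ) (s : ℝ) : ℝ :=
  (1 - s) / s * ∑' j : ℕ, s ^ (j + 1) * a j

lemma summable_pow_succ_mul {a : ℕ → ℝ} {C s : ℝ} (ha : ∀ j, |a j| ≤ C)
    (hs : s ∈ Set.Ioo (0 : ℝ) 1) : Summable fun j : ℕ => s ^ (j + 1) * a j := by
  refine Summable.of_norm_bounded
    (((summable_geometric_of_lt_one hs.1.le hs.2).mul_left s).mul_right C) fun j => ?_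
  have h := pow_pos hs.1 (j + 1)
  rw [Real.norm_eq_abs, abs_mul, abs_of_pos h, ← pow_succ']
  exact mul_le_mul_of_nonneg_left (ha j) h.le

lemma abelMean_const (c : ℝ) {s : ℝ} (hs : s ∈ Set.Ioo (0 : ℝ) 1) :
    abelMean (fun _ => c) s = c := by
  have h0 : s ≠ 0 := hs.1.ne'
  have h1 : 1 - s ≠ 0 := (sub_pos.2 hs.2).ne'
  simp only [abelMean, pow_succ]
  rw [tsum_mul_right, tsum_mul_right, tsum_geometric_of_lt_one hs.1.le hs.2]
  field_simp

lemma abelMean_add {a b : ℕ → ℝ} {C D s : ℝ} (ha : ∀ j, |a j| ≤ C) (hb : ∀ j, |b j| ≤ D)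
    (hs : s ∈ Set.Ioo (0 : ℝ) 1) :
    abelMean (fun j => a j + b j) s = abelMean a s + abelMean b s := by
  simp only [abelMean, mul_add]
  rw [(summable_pow_succ_mul ha hs).tsum_add (summable_pow_succ_mul hb hs), mul_add]

lemma abelMean_mono {a b : ℕ → ℝ} {C D s : ℝ} (ha : ∀ j, |a j| ≤ C) (hb : ∀ j, |b j| ≤ D)
    (hab : ∀ j, a j ≤ b j) (hs : s ∈ Set.Ioo (0 : ℝ) 1) : abelMean a s ≤ abelMean b s := by
  refine mul_le_mul_of_nonneg_left ?_ (div_nonneg (sub_nonneg.2 hs.2.le) hs.1.le)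
  exact (summable_pow_succ_mul ha hs).tsum_le_tsum
    (fun j => mul_le_mul_of_nonneg_left (hab j) (pow_pos hs.1 _).le)
    (summable_pow_succ_mul hb hs)

lemma abelMean_neg (a : ℕ → ℝ) (s : ℝ) : abelMean (fun j => -a j) s = -abelMean a s := by
  simp [abelMean, tsum_neg]

lemma abs_abelMean_le {a : ℕ → ℝ} {C s : ℝ} (ha : ∀ j, |a j| ≤ C)
    (hs : s ∈ Set.Ioo (0 : ℝ) 1) : |abelMean a s| ≤ C := by
  have hC : ∀ j : ℕ, |(fun _ : ℕ => C) j| ≤ |C| := fun _ => le_rfl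
  have hC' : ∀ j : ℕ, |(fun _ : ℕ => -C) j| ≤ |C| := fun _ => (abs_neg C).le
  have h1 := abelMean_mono ha hC (fun j => (abs_le.1 (ha j)).2) hs
  have h2 := abelMean_mono hC' ha (fun j => (abs_le.1 (ha j)).1) hs
  rw [abelMean_const _ hs] at h1 h2
  exact abs_le.2 ⟨h2, h1⟩

lemma tendsto_one_sub_div_self :
    Tendsto (fun s : ℝ => (1 - s) / s) (𝓝[Set.Ioo 0 1] 1) (𝓝 0) := by
  have h : ContinuousAt (fun s : ℝ => (1 - s) / s) 1 :=
    (continuousAt_const.sub continuousAt_id).div continuousAt_id one_ne_zero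
  simpa [ContinuousAt] using h.tendsto.mono_left (nhdsWithin_le_nhds (s := Set.Ioo 0 1))

lemma abelMean_succ_sub {v : ℕ → ℝ} {C s : ℝ} (hv : ∀ j, |v j| ≤ C)
    (hs : s ∈ Set.Ioo (0 : ℝ) 1) :
    abelMean (fun j => v (j + 1) - v j) s = (1 - s) / s * (abelMean v s - v 0) := by
  have h0 : s ≠ 0 := hs.1.ne'
  have hsum := summable_pow_succ_mul hv hs
  have hsum' := summable_pow_succ_mul (fun j => hv (j + 1)) hs
  have h := hsum.tsum_eq_zero_add
  have h' : ∑' j : ℕ, s ^ (j + 1 + 1) * v (j + 1) = s * ∑' j : ℕ, s ^ (j + 1) * v (j + 1) := by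
    rw [← tsum_mul_left]
    exact tsum_congr fun j => by ring
  rw [h'] at h
  simp only [abelMean, mul_sub]
  rw [hsum'.tsum_sub hsum]
  field_simp
  simp only [zero_add, pow_one] at h
  linear_combination (s - 1) * h

lemma tendsto_abelMean_succ_sub {v : ℕ → ℝ} {C : ℝ} (hv : ∀ j, |v j| ≤ C) :
    Tendsto (abelMean fun j => v (j + 1) - v j) (𝓝[Set.Ioo 0 1] 1) (𝓝 0) := by
  have h : Tendsto (fun s : ℝ => (1 - s) / s * (C + C)) (𝓝[Set.Ioo 0 1] 1) (𝓝 0) := by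
    simpa using tendsto_one_sub_div_self.mul_const (C + C)
  refine squeeze_zero_norm' ?_ h
  filter_upwards [self_mem_nhdsWithin] with s hs
  have hpos : 0 ≤ (1 - s) / s := div_nonneg (sub_nonneg.2 hs.2.le) hs.1.le
  rw [abelMean_succ_sub hv hs, Real.norm_eq_abs, abs_mul, abs_of_nonneg hpos]
  exact mul_le_mul_of_nonneg_left
    ((abs_sub _ _).trans (add_le_add (abs_abelMean_le hv hs) (hv 0))) hpos

lemma tendsto_abelMean_add_sub {v : ℕ → ℝ} {C : ℝ} (hv : ∀ j, |v j| ≤ C) (k : ℕ) :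
    Tendsto (abelMean fun j => v (j + k) - v j) (𝓝[Set.Ioo 0 1] 1) (𝓝 0) := by
  have hd (i l : ℕ) : |v i - v l| ≤ C + C := (abs_sub _ _).trans (add_le_add (hv i) (hv l))
  induction k with
  | zero =>
    refine tendsto_const_nhds.congr fun s => ?_
    simp [abelMean]
  | succ k ih =>
    have h := (tendsto_abelMean_succ_sub (v := fun j => v (j + k)) fun j => hv _).add ih
    rw [add_zero] at h
    refine h.congr' ?_
    filter_upwards [self_mem_nhdsWithin] with s hs
    rw [← abelMean_add (fun j => hd _ _) (fun j => hd _ _) hs]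
    refine congrArg (abelMean · s) (funext fun j => ?_)
    rw [show j + 1 + k = j + (k + 1) by ring]
    ring

/-- Abel means do not distinguish a bounded two-sided sequence from its translates. -/
lemma tendsto_abelMean_int_sub {u : ℤ → ℝ} {C : ℝ} (hu : ∀ j, |u j| ≤ C) (m : ℤ) :
    Tendsto (abelMean fun j => u (j + 1 - m) - u (j + 1)) (𝓝[Set.Ioo 0 1] 1) (𝓝 0) := by
  obtain ⟨k, rfl | rfl⟩ := m.eq_nat_or_neg
  · have h := (tendsto_abelMean_add_sub (v := fun j : ℕ => u (j + 1 - k)) (fun j => hu _) k).neg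
    rw [neg_zero] at h
    refine h.congr fun s => ?_
    rw [← abelMean_neg]
    refine congrArg (abelMean · s) (funext fun j => ?_)
    rw [neg_sub]
    congr 2
    push_cast
    ring
  · refine (tendsto_abelMean_add_sub (v := fun j : ℕ => u (j + 1)) (fun j => hu _) k).congr
      fun s => ?_
    refine congrArg (abelMean · s) (funext fun j => ?_)
    congr 2
    push_cast
    ring

lemma abs_ceil_sub_fract_le (x t : ℝ) : |(⌈x - Int.fract t⌉ : ℝ)| ≤ |x| + 2 := by
  have h1 := Int.fract_nonneg t
  have h2 := Int.fract_lt_one t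
  have h3 := Int.le_ceil (x - Int.fract t)
  have h4 := Int.ceil_lt_add_one (x - Int.fract t)
  rw [abs_le]
  constructor <;> linarith [neg_abs_le x, le_abs_self x]

lemma abs_one_add_floor_sub_fract_le (x t : ℝ) :
    |1 + (⌊x - Int.fract t⌋ : ℝ)| ≤ |x| + 2 := by
  have h1 := Int.fract_nonneg t
  have h2 := Int.fract_lt_one t
  have h3 := Int.floor_le (x - Int.fract t)
  have h4 := Int.lt_floor_add_one (x - Int.fract t)
  rw [abs_le]
  constructor <;> linarith [neg_abs_le x, le_abs_self x]

lemma UpsilonPlus_eq_abelMean (ξ x : ℝ) {s : ℝ} (hs : s ∈ Set.Ioo (0 : ℝ) 1) :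
    UpsilonPlus s ξ x =
      abelMean (fun j => 1 + (⌊x - Int.fract (((j : ℝ) + 1) * ξ)⌋ : ℝ)) s := by
  have hb (j : ℕ) : |(⌊x - Int.fract (((j : ℝ) + 1) * ξ)⌋ : ℝ)| ≤ |x| + 3 := by
    have h := abs_le.1 (abs_one_add_floor_sub_fract_le x (((j : ℝ) + 1) * ξ))
    exact abs_le.2 ⟨by linarith, by linarith⟩
  rw [abelMean_add (C := 1) (fun _ => abs_one.le) hb hs, abelMean_const 1 hs]
  rfl

lemma UpsilonMinus_mono (ξ : ℝ) {x y s : ℝ} (hxy : x ≤ y) (hs : s ∈ Set.Ioo (0 : ℝ) 1) :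
    UpsilonMinus s ξ x ≤ UpsilonMinus s ξ y :=
  abelMean_mono (fun _ => abs_ceil_sub_fract_le x _) (fun _ => abs_ceil_sub_fract_le y _)
    (fun _ => Int.cast_le.2 (Int.ceil_mono (sub_le_sub_right hxy _))) hs

lemma UpsilonMinus_le_UpsilonPlus (ξ x : ℝ) {s : ℝ} (hs : s ∈ Set.Ioo (0 : ℝ) 1) :
    UpsilonMinus s ξ x ≤ UpsilonPlus s ξ x := by
  rw [UpsilonPlus_eq_abelMean ξ x hs]
  refine abelMean_mono (fun _ => abs_ceil_sub_fract_le x _)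
    (fun _ => abs_one_add_floor_sub_fract_le x _) (fun j => ?_) hs
  have h := Int.ceil_le_floor_add_one (x - Int.fract (((j : ℝ) + 1) * ξ))
  rw [add_comm (1 : ℝ) (Int.cast _)]
  exact_mod_cast h

lemma UpsilonPlus_le_UpsilonMinus (ξ : ℝ) {x y s : ℝ} (hxy : x < y)
    (hs : s ∈ Set.Ioo (0 : ℝ) 1) : UpsilonPlus s ξ x ≤ UpsilonMinus s ξ y := by
  rw [UpsilonPlus_eq_abelMean ξ x hs]
  refine abelMean_mono (fun _ => abs_one_add_floor_sub_fract_le x _)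
    (fun _ => abs_ceil_sub_fract_le y _) (fun j => ?_) hs
  have h : ⌊x - Int.fract (((j : ℝ) + 1) * ξ)⌋ < ⌈y - Int.fract (((j : ℝ) + 1) * ξ)⌉ :=
    Int.lt_ceil.2 ((Int.floor_le _).trans_lt (sub_lt_sub_right hxy _))
  exact_mod_cast (add_comm _ _).trans_le (Int.add_one_le_iff.2 h)

lemma ceil_int_mul_add_int_sub_fract (ξ : ℝ) (m n j : ℤ) :
    (⌈m * ξ + n - Int.fract (j * ξ)⌉ : ℝ) =
      (m * ξ + n) + (Int.fract (((j - m : ℤ) : ℝ) * ξ) - Int.fract (j * ξ)) := by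
  have h : m * ξ + n - Int.fract (j * ξ) =
      -(((j - m : ℤ) : ℝ) * ξ) + ((n + ⌊j * ξ⌋ : ℤ) : ℝ) := by
    rw [Int.fract]
    push_cast
    ring
  rw [h, Int.ceil_add_intCast, Int.ceil_neg]
  simp only [Int.fract]
  push_cast
  ring

lemma tendsto_UpsilonMinus_int_mul_add_int (ξ : ℝ) (m n : ℤ) :
    Tendsto (fun s => UpsilonMinus s ξ (m * ξ + n)) (𝓝[Set.Ioo 0 1] 1) (𝓝 (m * ξ + n)) := by
  have hu (j : ℤ) : |Int.fract (j * ξ)| ≤ 1 := by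
    rw [Int.abs_fract]
    exact (Int.fract_lt_one _).le
  have h := (tendsto_abelMean_int_sub hu m).const_add (m * ξ + n)
  rw [add_zero] at h
  refine h.congr' ?_
  filter_upwards [self_mem_nhdsWithin] with s hs
  have hd (i l : ℤ) : |Int.fract (i * ξ) - Int.fract (l * ξ)| ≤ 1 + 1 :=
    (abs_sub _ _).trans (add_le_add (hu i) (hu l))
  rw [← abelMean_const (m * ξ + n) hs, ← abelMean_add (fun _ => le_rfl) (fun j => hd _ _) hs,
    abelMean_const (m * ξ + n) hs]
  refine congrArg (abelMean · s) (funext fun j => ?_)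
  rw [← ceil_int_mul_add_int_sub_fract ξ m n (j + 1)]
  push_cast
  rfl

lemma Irrational.exists_int_mul_add_int_mem_Ioo {ξ : ℝ} (hirr : Irrational ξ) {a b : ℝ}
    (hab : a < b) : ∃ m n : ℤ, m * ξ + n ∈ Set.Ioo a b := by
  have h : Dense (AddSubgroup.closure {ξ, 1} : Set ℝ) :=
    dense_addSubgroupClosure_pair_iff.2 (by simpa using hirr)
  obtain ⟨y, hy, hmem⟩ := h.exists_between hab
  obtain ⟨m, n, rfl⟩ := AddSubgroup.mem_closure_pair.1 hy
  exact ⟨m, n, by simpa using hmem⟩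

theorem stmt_15 (ξ : ℝ) (hξ : 0 < ξ) (hirr : Irrational ξ) (x : ℝ) :
    Filter.Tendsto (fun s => UpsilonMinus s ξ x)
      (nhdsWithin 1 (Set.Ioo 0 1)) (nhds x) ∧
    Filter.Tendsto (fun s => UpsilonPlus s ξ x)
      (nhdsWithin 1 (Set.Ioo 0 1)) (nhds x) := by
  have lower : ∀ a < x, ∀ᶠ s in 𝓝[Set.Ioo 0 1] 1, a < UpsilonMinus s ξ x := fun a ha => by
    obtain ⟨m, n, hm⟩ := hirr.exists_int_mul_add_int_mem_Ioo ha
    filter_upwards [self_mem_nhdsWithin,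
      (tendsto_UpsilonMinus_int_mul_add_int ξ m n).eventually_const_lt hm.1] with s hs h
    exact h.trans_le (UpsilonMinus_mono ξ hm.2.le hs)
  have upper : ∀ b > x, ∀ᶠ s in 𝓝[Set.Ioo 0 1] 1, UpsilonPlus s ξ x < b := fun b hb => by
    obtain ⟨m, n, hm⟩ := hirr.exists_int_mul_add_int_mem_Ioo hb
    filter_upwards [self_mem_nhdsWithin,
      (tendsto_UpsilonMinus_int_mul_add_int ξ m n).eventually_lt_const hm.2] with s hs h
    exact (UpsilonPlus_le_UpsilonMinus ξ hm.1 hs).trans_lt h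
  refine ⟨tendsto_order.2 ⟨lower, fun b hb => ?_⟩, tendsto_order.2 ⟨fun a ha => ?_, upper⟩⟩
  · filter_upwards [self_mem_nhdsWithin, upper b hb] with s hs h
    exact (UpsilonMinus_le_UpsilonPlus ξ x hs).trans_lt h
  · filter_upwards [self_mem_nhdsWithin, lower a ha] with s hs h
    exact h.trans_le (UpsilonMinus_le_UpsilonPlus ξ x hs)
end
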